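/- Let k ≥ 5 and ℓ ≥ 33. There is no mixed 1-stack 1-queue layout of G(k,ℓ) in which there exist vertices u ≺ v with {u,v} a queue-edge of G(2,ℓ) and five vertices x1 ≺ x2 ≺ x3 ≺ x4 ≺ x5 of Ḡ(3,ℓ), each attached to {u,v}, such that for every i with 1 ≤ i ≤ 5 one has v ≺ x_i, the edge {u,x_i} is a queue-edge, and the edge {v,x_i} is a stack-edge. -/

import Mathlib

/-- Vertices for the graphs `G(k,ℓ)`: two base vertices and, for each step `k`,
each oriented edge `(u,v)` and each index `i : Fin ℓ`, a potential attached vertex. -/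
inductive PV (ℓ : ℕ) : Type where
  | A : PV ℓ
  | B : PV ℓ
  | att : ℕ → PV ℓ → PV ℓ → Fin ℓ → PV ℓ

/-- The (canonically oriented) edges of `G(k,ℓ)`: `G(1,ℓ)` is the single edge `(A,B)`,
and for `k > 1`, `G(k,ℓ)` is obtained from `G(k-1,ℓ)` by attaching `ℓ` new vertices
to each of its edges. -/
def Gedges (ℓ : ℕ) : ℕ → Set (PV ℓ × PV ℓ)
  | 0 => ∅
  | 1 => {p | p = (PV.A, PV.B)}
  | (k + 2) => Gedges ℓ (k + 1) ∪
      {p | ∃ u v, ∃ i : Fin ℓ, (u, v) ∈ Gedges ℓ (k + 1) ∧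
        (p = (PV.att (k + 2) u v i, u) ∨ p = (PV.att (k + 2) u v i, v))}

/-- The graph `G(k,ℓ)`. -/
def Gkl (k ℓ : ℕ) : SimpleGraph (PV ℓ) :=
  SimpleGraph.fromEdgeSet ((fun p => s(p.1, p.2)) '' Gedges ℓ k)

/-- The graph `Ḡ(k,ℓ)` induced by the edges of `G(k,ℓ)` that are not in `G(k-1,ℓ)`. -/
def Gbar (k ℓ : ℕ) : SimpleGraph (PV ℓ) :=
  SimpleGraph.fromEdgeSet ((fun p => s(p.1, p.2)) '' (Gedges ℓ k \ Gedges ℓ (k - 1)))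

/-- A mixed 1-stack 1-queue layout of a graph `G`: a strict total (linear) order `lt`
on the vertices together with an assignment of each edge to the stack (`isStack e`)
or to the queue (`¬ isStack e`), such that no two stack-edges cross and no two
queue-edges nest. -/
structure MixedLayout {V : Type} (G : SimpleGraph V) where
  lt : V → V → Prop
  isSTO : IsStrictTotalOrder V lt
  isStack : Sym2 V → Prop
  noCross : ∀ a b c d : V, G.Adj a b → G.Adj c d →
    isStack s(a, b) → isStack s(c, d) → ¬(lt a c ∧ lt c b ∧ lt b d)
  noNest : ∀ a b c d : V, G.Adj a b → G.Adj c d →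
    ¬isStack s(a, b) → ¬isStack s(c, d) → ¬(lt a c ∧ lt c d ∧ lt d b)

/-- `{a,b}` is an edge of the subgraph `H` that is a stack-edge in the layout `L`. -/
def SEdgeIn {V : Type} {G : SimpleGraph V} (L : MixedLayout G) (H : SimpleGraph V)
    (a b : V) : Prop :=
  H.Adj a b ∧ L.isStack s(a, b)

/-- `{a,b}` is an edge of the subgraph `H` that is a queue-edge in the layout `L`. -/
def QEdgeIn {V : Type} {G : SimpleGraph V} (L : MixedLayout G) (H : SimpleGraph V)
    (a b : V) : Prop :=
  H.Adj a b ∧ ¬L.isStack s(a, b)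

/-- `x` is a stack-attachment of the edge `{u,v}`: both `{x,u}` and `{x,v}` are
stack-edges. -/
def StackAtt {V : Type} {G : SimpleGraph V} (L : MixedLayout G) (x u v : V) : Prop :=
  SEdgeIn L G x u ∧ SEdgeIn L G x v

/-- `x` is a queue-attachment of the edge `{u,v}`: both `{x,u}` and `{x,v}` are
queue-edges. -/
def QueueAtt {V : Type} {G : SimpleGraph V} (L : MixedLayout G) (x u v : V) : Prop :=
  QEdgeIn L G x u ∧ QEdgeIn L G x v

/-- `x` is a mixed-attachment of the edge `{u,v}`: one of `{x,u}`, `{x,v}` is a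
stack-edge and the other is a queue-edge. -/
def MixedAtt {V : Type} {G : SimpleGraph V} (L : MixedLayout G) (x u v : V) : Prop :=
  (SEdgeIn L G x u ∧ QEdgeIn L G x v) ∨ (QEdgeIn L G x u ∧ SEdgeIn L G x v)

/-- `x` is one of the vertices of `Ḡ(k,ℓ)` attached to the edge `{u,v}`, i.e. both
`{x,u}` and `{x,v}` are edges of `Ḡ(k,ℓ)`. -/
def AttachedAt (ℓ k : ℕ) (x u v : PV ℓ) : Prop :=
  (Gbar k ℓ).Adj x u ∧ (Gbar k ℓ).Adj x v

/-- A smiley face `⟨a,b,u,v,c,d⟩` formed by vertices and edges of the subgraph `H`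
in the layout `L`: `a ≺ b ≺ u ≺ v ≺ c ≺ d`, the edges `{a,b}`, `{c,d}`, `{a,d}` of `H`
are queue-edges and the edge `{u,v}` of `H` is a stack-edge. -/
def Smiley {V : Type} {G : SimpleGraph V} (L : MixedLayout G) (H : SimpleGraph V)
    (a b u v c d : V) : Prop :=
  L.lt a b ∧ L.lt b u ∧ L.lt u v ∧ L.lt v c ∧ L.lt c d ∧
  QEdgeIn L H a b ∧ QEdgeIn L H c d ∧ QEdgeIn L H a d ∧ SEdgeIn L H u v

namespace PV

/-- The step at which a vertex is added (`0` for the two base vertices). -/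
def level {ℓ : ℕ} : PV ℓ → ℕ
  | A => 0
  | B => 0
  | att n _ _ _ => n

/-- The edge to which a vertex is attached (a dummy loop for the two base vertices). -/
def parent {ℓ : ℕ} : PV ℓ → Sym2 (PV ℓ)
  | A => s(A, A)
  | B => s(A, A)
  | att _ u v _ => s(u, v)

end PV

theorem Gedges_subset_succ (ℓ k : ℕ) : Gedges ℓ k ⊆ Gedges ℓ (k + 1) := by
  cases k with
  | zero => simp [Gedges]
  | succ k => exact Set.subset_union_left

theorem level_le_of_mem_Gedges {ℓ k : ℕ} {a b : PV ℓ} (h : (a, b) ∈ Gedges ℓ k) :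
    a.level ≤ k ∧ b.level ≤ k := by
  induction k generalizing a b with
  | zero => simp [Gedges] at h
  | succ k ih =>
    cases k with
    | zero =>
      simp only [Gedges, Set.mem_ofPred_eq, Prod.mk.injEq] at h
      simp [h.1, h.2, PV.level]
    | succ k =>
      rcases h with h | ⟨u, v, i, huv, h | h⟩
      · have := ih h
        omega
      all_goals
        have := ih huv
        obtain ⟨rfl, rfl⟩ := Prod.mk.inj h
        refine ⟨le_rfl, ?_⟩
        omega

theorem Gkl_adj_iff {ℓ k : ℕ} {a b : PV ℓ} :
    (Gkl k ℓ).Adj a b ↔ ((a, b) ∈ Gedges ℓ k ∨ (b, a) ∈ Gedges ℓ k) ∧ a ≠ b := by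
  simp only [Gkl, SimpleGraph.fromEdgeSet_adj, Set.mem_image, Prod.exists, Sym2.eq_iff]
  grind

theorem Gkl_mono (ℓ : ℕ) : Monotone (fun k => Gkl k ℓ) := by
  refine monotone_nat_of_le_succ fun k => ?_
  exact SimpleGraph.fromEdgeSet_mono (Set.image_mono (Gedges_subset_succ ℓ k))

theorem Gbar_le_Gkl (k ℓ : ℕ) : Gbar k ℓ ≤ Gkl k ℓ :=
  SimpleGraph.fromEdgeSet_mono (Set.image_mono Set.sdiff_subset)

theorem level_le_of_Gkl_adj {ℓ k : ℕ} {a b : PV ℓ} (h : (Gkl k ℓ).Adj a b) :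
    a.level ≤ k ∧ b.level ≤ k := by
  rcases (Gkl_adj_iff.1 h).1 with h | h
  · exact level_le_of_mem_Gedges h
  · exact (level_le_of_mem_Gedges h).symm

/-- Every edge of `G(k,ℓ)` has `ℓ` distinct attached vertices at step `k + 1`. -/
theorem exists_attachments {ℓ k : ℕ} {a b : PV ℓ} (h : (Gkl k ℓ).Adj a b) :
    ∃ f : Fin ℓ → PV ℓ, Function.Injective f ∧
      ∀ i, (Gkl (k + 1) ℓ).Adj (f i) a ∧ (Gkl (k + 1) ℓ).Adj (f i) b ∧
        (f i).level = k + 1 ∧ (f i).parent = s(a, b) := by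
  have oriented : ∀ a b : PV ℓ, (a, b) ∈ Gedges ℓ k → ∃ f : Fin ℓ → PV ℓ,
      Function.Injective f ∧
      ∀ i, (Gkl (k + 1) ℓ).Adj (f i) a ∧ (Gkl (k + 1) ℓ).Adj (f i) b ∧
        (f i).level = k + 1 ∧ (f i).parent = s(a, b) := by
    intro a b h
    have hlev := level_le_of_mem_Gedges h
    cases k with
    | zero => simp [Gedges] at h
    | succ k =>
      refine ⟨fun i => PV.att (k + 2) a b i, fun i j hij => by simpa using hij, fun i => ?_⟩
      refine ⟨Gkl_adj_iff.2 ⟨Or.inl (Or.inr ⟨a, b, i, h, Or.inl rfl⟩), ?_⟩,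
        Gkl_adj_iff.2 ⟨Or.inl (Or.inr ⟨a, b, i, h, Or.inr rfl⟩), ?_⟩, rfl, rfl⟩
      · intro he
        have : k + 2 = a.level := congrArg PV.level he
        omega
      · intro he
        have : k + 2 = b.level := congrArg PV.level he
        omega
  rcases (Gkl_adj_iff.1 h).1 with h | h
  · exact oriented a b h
  · obtain ⟨f, hf, hatt⟩ := oriented b a h
    exact ⟨f, hf, fun i => ⟨(hatt i).2.1, (hatt i).1, (hatt i).2.2.1,
      (hatt i).2.2.2.trans Sym2.eq_swap⟩⟩

/-- A pair of symmetric relations on a linear order, thought of as the stack-edges `S`, no two of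
which cross, and the queue-edges `Q`, no two of which nest. -/
structure StackQueue {V : Type*} [LinearOrder V] (S Q : V → V → Prop) : Prop where
  stack_symm : ∀ a b, S a b → S b a
  queue_symm : ∀ a b, Q a b → Q b a
  noCross : ∀ a b c d, S a b → S c d → a < c → c < b → b < d → False
  noNest : ∀ a b c d, Q a b → Q c d → a < c → c < d → d < b → False

namespace StackQueue

variable {V : Type*} [LinearOrder V] {S Q : V → V → Prop}

theorem stack_of_inside (h : StackQueue S Q) {u m a b : V} (hum : Q u m) (ha : u < a)
    (ham : a < m) (hb : u < b) (hbm : b < m) (hne : a ≠ b) (hab : S a b ∨ Q a b) : S a b := by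
  refine hab.resolve_right fun hq => ?_
  rcases lt_or_gt_of_ne hne with hlt | hlt
  · exact h.noNest _ _ _ _ hum hq ha hlt hbm
  · exact h.noNest _ _ _ _ hum (h.queue_symm _ _ hq) hb hlt ham

/-- A neighbour `t` of a vertex `b` lying below a stack-edge `vq` and a queue-edge `um`, where
`uv` is a queue-edge, lies to the right of `v`. -/
theorem neighbour_pos (h : StackQueue S Q) {u v b q m t : V} (huv : u < v) (hvb : v < b)
    (hbq : b < q) (hqm : q < m) (quv : Q u v) (qum : Q u m) (svq : S v q)
    (htu : t ≠ u) (htv : t ≠ v) (htb : t ≠ b) (e : S t b ∨ Q t b) :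
    v < t ∧ (t < m → S t b ∧ t ≤ q) ∧ (q < t → Q t b) := by
  have hvt : v < t := by
    by_contra! hle
    have hlt := lt_of_le_of_ne hle htv
    have hns : ¬ S t b := fun hs => h.noCross _ _ _ _ hs svq hlt hvb hbq
    have hq := e.resolve_left hns
    rcases lt_or_gt_of_ne htu with htu | htu
    · exact h.noNest _ _ _ _ hq quv htu huv hvb
    · exact h.noNest _ _ _ _ qum hq htu (hlt.trans hvb) (hbq.trans hqm)
  have hqt : q < t → Q t b := fun hqt =>
    e.resolve_left fun hs => h.noCross _ _ _ _ svq (h.stack_symm _ _ hs) hvb hbq hqt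
  refine ⟨hvt, fun htm => ?_, hqt⟩
  have hs := h.stack_of_inside qum (huv.trans hvt) htm (huv.trans hvb) (hbq.trans hqm) htb e
  refine ⟨hs, ?_⟩
  by_contra! hlt
  exact h.noCross _ _ _ _ svq (h.stack_symm _ _ hs) hvb hbq hlt

/-- Two vertices joined by stack-edges to both `a` and `b` are separated by `a` or `b`. -/
theorem eq_of_stack_attached (h : StackQueue S Q) {a b t t' : V} (hab : a < b)
    (hta : S t a) (htb : S t b) (hta' : S t' a) (htb' : S t' b)
    (hat : a < t ↔ a < t') (hbt : b < t ↔ b < t') (h1 : t ≠ a) (h2 : t ≠ b) (h3 : t' ≠ a)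
    (h4 : t' ≠ b) : t = t' := by
  have key : ∀ t t', S t a → S t b → S t' a → S t' b → (a < t ↔ a < t') → (b < t ↔ b < t') →
      t ≠ a → t ≠ b → t' ≠ a → t' ≠ b → ¬ t < t' := by
    intro t t' hta htb hta' htb' hat hbt h1 h2 h3 h4 hlt
    rcases lt_or_gt_of_ne h1 with ha | ha
    · have ha' : t' < a := lt_of_le_of_ne (not_lt.1 (fun hc => (hat.2 hc).asymm ha)) h3
      exact h.noCross _ _ _ _ hta htb' hlt ha' hab
    rcases lt_or_gt_of_ne h2 with hb | hb
    · have hb' : t' < b := lt_of_le_of_ne (not_lt.1 (fun hc => (hbt.2 hc).asymm hb)) h4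
      exact h.noCross _ _ _ _ (h.stack_symm _ _ hta') htb ha hlt hb'
    · exact h.noCross _ _ _ _ (h.stack_symm _ _ hta) (h.stack_symm _ _ htb') hab hb hlt
  rcases lt_trichotomy t t' with hlt | heq | hlt
  · exact (key _ _ hta htb hta' htb' hat hbt h1 h2 h3 h4 hlt).elim
  · exact heq
  · exact (key _ _ hta' htb' hta htb hat.symm hbt.symm h3 h4 h1 h2 hlt).elim

/-- Among three vertices attached to a stack-edge `vb`, one lies to the right of `m`. -/
theorem exists_attachment_right (h : StackQueue S Q) {u v b q m : V} (huv : u < v) (hvb : v < b)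
    (hbq : b < q) (hqm : q < m) (quv : Q u v) (qum : Q u m) (svq : S v q)
    (f : Fin 3 → V) (hf : Function.Injective f)
    (hne : ∀ i, f i ≠ u ∧ f i ≠ v ∧ f i ≠ b ∧ f i ≠ m)
    (e : ∀ i, (S (f i) v ∨ Q (f i) v) ∧ (S (f i) b ∨ Q (f i) b)) :
    ∃ i, m < f i ∧ Q (f i) b := by
  have pos i := h.neighbour_pos huv hvb hbq hqm quv qum svq (hne i).1 (hne i).2.1 (hne i).2.2.1
    (e i).2
  by_contra! hno
  have hlt i : f i < m := lt_of_le_of_ne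
    (not_lt.1 fun hc => hno i hc ((pos i).2.2 (hqm.trans hc))) (hne i).2.2.2
  have hsv i : S (f i) v := h.stack_of_inside qum (huv.trans (pos i).1) (hlt i) huv
    (hvb.trans (hbq.trans hqm)) (hne i).2.1 (e i).1
  obtain ⟨i, j, hij, hc⟩ := Fintype.exists_ne_map_eq_of_card_lt
    (fun i => decide (b < f i)) (by simp)
  refine hij (hf (h.eq_of_stack_attached hvb (hsv i) ((pos i).2.1 (hlt i)).1 (hsv j)
    ((pos j).2.1 (hlt j)).1 ?_ ?_ (hne i).2.1 (hne i).2.2.1 (hne j).2.1 (hne j).2.2.1))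
  · simp [(pos i).1, (pos j).1]
  · simpa using hc

/-- No five vertices are attached to an edge `ab` if `vq` is a stack-edge and `uv` and `um` are
queue-edges with `u < v < a < b < q < m`. -/
theorem not_five_attachments (h : StackQueue S Q) {u v a b q m : V} (huv : u < v)
    (hva : v < a) (hab : a < b) (hbq : b < q) (hqm : q < m) (quv : Q u v) (qum : Q u m)
    (svq : S v q) (f : Fin 5 → V) (hf : Function.Injective f)
    (hne : ∀ i, f i ≠ u ∧ f i ≠ v ∧ f i ≠ a ∧ f i ≠ b ∧ f i ≠ m)
    (e : ∀ i, (S (f i) a ∨ Q (f i) a) ∧ (S (f i) b ∨ Q (f i) b)) : False := by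
  have posa i := h.neighbour_pos huv hva (hab.trans hbq) hqm quv qum svq (hne i).1 (hne i).2.1
    (hne i).2.2.1 (e i).1
  have posb i := h.neighbour_pos huv (hva.trans hab) hbq hqm quv qum svq (hne i).1 (hne i).2.1
    (hne i).2.2.2.1 (e i).2
  have right : ∀ i j, m < f i → m < f j → ¬ f i < f j := fun i j hi hj hlt =>
    h.noNest _ _ _ _ (h.queue_symm _ _ ((posa j).2.2 (hqm.trans hj)))
      (h.queue_symm _ _ ((posb i).2.2 (hqm.trans hi))) hab
      (hbq.trans (hqm.trans hi)) hlt
  let c : Fin 5 → Fin 4 := fun i =>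
    if m < f i then 3 else if b < f i then 2 else if a < f i then 1 else 0
  obtain ⟨i, j, hij, hc⟩ := Fintype.exists_ne_map_eq_of_card_lt c (by simp)
  have hcases : (m < f i ↔ m < f j) ∧ (¬ m < f i → ((b < f i ↔ b < f j) ∧
      (a < f i ↔ a < f j))) := by
    have hbm := hbq.trans hqm
    simp only [c] at hc
    split_ifs at hc <;> first | (simp at hc; done) | (constructor <;> grind)
  by_cases hi : m < f i
  · have hj := hcases.1.1 hi
    rcases lt_trichotomy (f i) (f j) with hlt | heq | hlt
    · exact right i j hi hj hlt
    · exact hij (hf heq)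
    · exact right j i hj hi hlt
  · have hj : ¬ m < f j := fun hc => hi (hcases.1.2 hc)
    have hi' := lt_of_le_of_ne (not_lt.1 hi) (hne i).2.2.2.2
    have hj' := lt_of_le_of_ne (not_lt.1 hj) (hne j).2.2.2.2
    exact hij (hf (h.eq_of_stack_attached hab ((posa i).2.1 hi').1 ((posb i).2.1 hi').1
      ((posa j).2.1 hj').1 ((posb j).2.1 hj').1 (hcases.2 hi).2 (hcases.2 hi).1
      (hne i).2.2.1 (hne i).2.2.2.1 (hne j).2.2.1 (hne j).2.2.2.1))

/-- A vertex `w` attached to the edge `u x₂` lies between `x₁` and `x₃`, provided that `x₁` and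
`x₃` have suitable neighbours `y₁` and `y₃` to the right of `m`. -/
theorem attachment_between (h : StackQueue S Q) {u v x₁ x₂ x₃ m y₁ y₃ w : V} (huv : u < v)
    (hv1 : v < x₁) (h12 : x₁ < x₂) (h23 : x₂ < x₃) (h3m : x₃ < m) (quv : Q u v) (qum : Q u m)
    (s1 : S v x₁) (s3 : S v x₃) (hy1 : m < y₁) (hy3 : m < y₃) (qy1 : Q y₁ x₁) (qy3 : Q y₃ x₃)
    (e3 : S y₃ v ∨ Q y₃ v) (hy : y₁ ≠ y₃) (hw1 : w ≠ y₁) (hw3 : w ≠ y₃)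
    (hwu : w ≠ u) (hwv : w ≠ v) (hwx1 : w ≠ x₁) (hwx2 : w ≠ x₂) (hwx3 : w ≠ x₃) (hwm : w ≠ m)
    (eu : S w u ∨ Q w u) (ex : S w x₂ ∨ Q w x₂) : x₁ < w ∧ w < x₃ := by
  have q1 := h.queue_symm _ _ qy1
  have q3 := h.queue_symm _ _ qy3
  have h13 := h12.trans h23
  have h1m := h13.trans h3m
  have hy13 : y₁ < y₃ := by
    by_contra! hle
    exact h.noNest _ _ _ _ q1 q3 h13 (h3m.trans hy3) (lt_of_le_of_ne hle hy.symm)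
  have sv3 : S v y₃ := h.stack_symm _ _ (e3.resolve_right fun hq =>
    h.noNest _ _ _ _ (h.queue_symm _ _ hq) q1 hv1 (h1m.trans hy1) hy13)
  obtain ⟨hvw, hin, hout⟩ :=
    h.neighbour_pos huv (hv1.trans h12) h23 h3m quv qum s3 hwu hwv hwx2 ex
  have hwlt : w < m := by
    by_contra! hle
    have hmw := lt_of_le_of_ne hle hwm.symm
    have q2 := h.queue_symm _ _ (hout (h3m.trans hmw))
    rcases eu with hs | hq
    · rcases lt_or_gt_of_ne hw3 with hlt | hlt
      · exact h.noCross _ _ _ _ (h.stack_symm _ _ hs) sv3 huv hvw hlt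
      · exact h.noNest _ _ _ _ q2 q3 h23 (h3m.trans hy3) hlt
    · rcases lt_or_gt_of_ne hw1 with hlt | hlt
      · exact h.noNest _ _ _ _ q1 q2 h12 ((h23.trans h3m).trans hmw) hlt
      · exact h.noNest _ _ _ _ (h.queue_symm _ _ hq) q1 (huv.trans hv1) (h1m.trans hy1) hlt
  obtain ⟨hs, hle⟩ := hin hwlt
  refine ⟨?_, lt_of_le_of_ne hle hwx3⟩
  by_contra! hle'
  exact h.noCross _ _ _ _ s1 hs hvw (lt_of_le_of_ne hle' hwx1) h12

end StackQueue

/-- For `k ≥ 5`, `ℓ ≥ 33`, there is no mixed layout of `G(k,ℓ)` with vertices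
`u ≺ v`, `{u,v}` a queue-edge of `G(2,ℓ)`, and five vertices
`x 0 ≺ x 1 ≺ x 2 ≺ x 3 ≺ x 4` of `Ḡ(3,ℓ)` attached to `{u,v}` such that for every
`j` one has `v ≺ x j`, the edge `{u, x j}` is a queue-edge and the edge `{v, x j}`
is a stack-edge. -/
theorem no_configuration_one (k ℓ : ℕ) (hk : 5 ≤ k) (hl : 33 ≤ ℓ)
    (L : MixedLayout (Gkl k ℓ)) :
    ¬∃ (u v : PV ℓ) (x : Fin 5 → PV ℓ),
      L.lt u v ∧ QEdgeIn L (Gkl 2 ℓ) u v ∧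
      (∀ j j' : Fin 5, j < j' → L.lt (x j) (x j')) ∧
      (∀ j : Fin 5, AttachedAt ℓ 3 (x j) u v ∧ L.lt v (x j) ∧
        QEdgeIn L (Gkl k ℓ) u (x j) ∧ SEdgeIn L (Gkl k ℓ) v (x j)) := by
  classical
  rintro ⟨u, v, x, huv, quv, hx, hatt⟩
  have := L.isSTO
  let _ : LinearOrder (PV ℓ) := linearOrderOfSTO L.lt
  have h : StackQueue (SEdgeIn L (Gkl k ℓ)) (QEdgeIn L (Gkl k ℓ)) :=
    { stack_symm := fun a b hab => ⟨hab.1.symm, Sym2.eq_swap (a := a) (b := b) ▸ hab.2⟩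
      queue_symm := fun a b hab => ⟨hab.1.symm, Sym2.eq_swap (a := a) (b := b) ▸ hab.2⟩
      noCross := fun a b c d hab hcd h1 h2 h3 =>
        L.noCross a b c d hab.1 hcd.1 hab.2 hcd.2 ⟨h1, h2, h3⟩
      noNest := fun a b c d hab hcd h1 h2 h3 =>
        L.noNest a b c d hab.1 hcd.1 hab.2 hcd.2 ⟨h1, h2, h3⟩ }
  have edge {a b : PV ℓ} {j : ℕ} (hj : j ≤ 5) (hab : (Gkl j ℓ).Adj a b) :
      SEdgeIn L (Gkl k ℓ) a b ∨ QEdgeIn L (Gkl k ℓ) a b := by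
    have hadj : (Gkl k ℓ).Adj a b := Gkl_mono ℓ (hj.trans hk) hab
    by_cases hs : L.isStack s(a, b)
    · exact Or.inl ⟨hadj, hs⟩
    · exact Or.inr ⟨hadj, hs⟩
  have huv : u < v := huv
  have hx {i j : Fin 5} (hij : i < j) : x i < x j := hx i j hij
  have hvx j : v < x j := (hatt j).2.1
  have qux j := (hatt j).2.2.1
  have svx j := (hatt j).2.2.2
  have gxu j : (Gkl 3 ℓ).Adj (x j) u := Gbar_le_Gkl 3 ℓ (hatt j).1.1
  have gxv j : (Gkl 3 ℓ).Adj (x j) v := Gbar_le_Gkl 3 ℓ (hatt j).1.2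
  have lu : u.level ≤ 3 := (level_le_of_Gkl_adj (gxu 0)).2
  have lv : v.level ≤ 3 := (level_le_of_Gkl_adj (gxv 0)).2
  have lx j : (x j).level ≤ 3 := (level_le_of_Gkl_adj (gxu j)).1
  have quv : QEdgeIn L (Gkl k ℓ) u v := ⟨Gkl_mono ℓ (by omega : 2 ≤ k) quv.1, quv.2⟩
  have ne_of_level {a b : PV ℓ} {n : ℕ} (ha : a.level = n + 1) (hb : b.level ≤ n) : a ≠ b := by
    rintro rfl
    omega
  have right (i : Fin 5) (j : Fin 5) (hij : i < j) (hj : j < 4) :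
      ∃ y, (Gkl 4 ℓ).Adj y v ∧ y.parent = s(x i, v) ∧ x 4 < y ∧
        QEdgeIn L (Gkl k ℓ) y (x i) := by
    obtain ⟨f, hf, hatt⟩ := exists_attachments (gxv i)
    obtain ⟨n, hn, hq⟩ := h.exists_attachment_right huv (hvx i) (hx hij) (hx hj) quv (qux 4)
      (svx j) (fun n => f (Fin.castLE (by omega) n))
      (hf.comp (Fin.castLE_injective (by omega)))
      (fun n => ⟨ne_of_level (hatt _).2.2.1 lu, ne_of_level (hatt _).2.2.1 lv,
        ne_of_level (hatt _).2.2.1 (lx _), ne_of_level (hatt _).2.2.1 (lx _)⟩)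
      (fun n => ⟨edge (by norm_num) (hatt _).2.1, edge (by norm_num) (hatt _).1⟩)
    exact ⟨_, (hatt _).2.1, (hatt _).2.2.2, hn, hq⟩
  obtain ⟨y₁, -, py1, hy1, qy1⟩ := right 0 1 (by decide) (by decide)
  obtain ⟨y₃, gy3, py3, hy3, qy3⟩ := right 2 3 (by decide) (by decide)
  obtain ⟨f, -, hf⟩ := exists_attachments (gxu 1)
  obtain ⟨gx, gu, lw, pw⟩ := hf ⟨0, by omega⟩
  set w := f ⟨0, by omega⟩
  have hwx j : w ≠ x j := ne_of_level lw (lx j)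
  have hx01 : x 0 < x 1 := hx (by decide)
  have hx12 : x 1 < x 2 := hx (by decide)
  have hx24 : x 2 < x 4 := hx (by decide)
  have hparent {a b c : PV ℓ} (hac : a ≠ c) (hav : a ≠ v) {y z : PV ℓ}
      (hy : y.parent = s(a, b)) (hz : z.parent = s(c, v)) : y ≠ z := by
    rintro rfl
    have := hy.symm.trans hz
    simp only [Sym2.eq_iff] at this
    tauto
  obtain ⟨h0w, hw2⟩ := h.attachment_between huv (hvx 0) hx01 hx12 hx24 quv (qux 4) (svx 0) (svx 2)
    hy1 hy3 qy1 qy3 (edge (by norm_num) gy3)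
    (hparent (hx01.trans hx12).ne (hvx 0).ne' py1 py3)
    (hparent hx01.ne' (hvx 1).ne' pw py1) (hparent hx12.ne (hvx 1).ne' pw py3)
    (ne_of_level lw lu) (ne_of_level lw lv) (hwx 0) (hwx 1) (hwx 2) (hwx 4)
    (edge (by norm_num) gu) (edge (by norm_num) gx)
  have four {a : PV ℓ} (ha : a.level ≤ 3) : a.level ≤ 4 := ha.trans (by norm_num)
  obtain ⟨g, hg, hgatt⟩ := exists_attachments gx
  have hg5 : Function.Injective (fun n : Fin 5 => g (Fin.castLE (by omega) n)) :=
    hg.comp (Fin.castLE_injective (by omega))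
  have hgne n {a : PV ℓ} (ha : a.level ≤ 4) : g n ≠ a := ne_of_level (hgatt n).2.2.1 ha
  rcases lt_or_gt_of_ne (hwx 1) with hlt | hlt
  · exact h.not_five_attachments huv ((hvx 0).trans h0w) hlt hx12 hx24 quv (qux 4) (svx 2) _ hg5
      (fun n => ⟨hgne _ (four lu), hgne _ (four lv), hgne _ lw.le, hgne _ (four (lx 1)),
        hgne _ (four (lx 4))⟩)
      (fun n => ⟨edge le_rfl (hgatt _).1, edge le_rfl (hgatt _).2.1⟩)
  · exact h.not_five_attachments huv (hvx 1) hlt hw2 hx24 quv (qux 4) (svx 2) _ hg5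
      (fun n => ⟨hgne _ (four lu), hgne _ (four lv), hgne _ (four (lx 1)), hgne _ lw.le,
        hgne _ (four (lx 4))⟩)
      (fun n => ⟨edge le_rfl (hgatt _).2.1, edge le_rfl (hgatt _).1⟩)
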